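/- Let U ⊆ ℝ³ × ℝ be an open set, let H : U → ℝ³ be continuous, and let d = (d₁,d₂,d₃) : U → ℝ³ be C² with |d(x,t)| = 1 and d₃(x,t) > −1 for all (x,t) ∈ U. Define v = (v₁,v₂) : U → ℝ² by vⱼ = dⱼ/(1 + d₃) for j = 1,2, so that Ψ ∘ v = d, and set h = 1 + v₁² + v₂². If d satisfies pointwise on U the harmonic map heat flow with external field, ∂ₜd − Δd = |∇d|² d + (H·d)H − (H·d)² d, then v is C² and satisfies pointwise on U: ∂ₜv = Δv − 2∇v·∇(log h) + (2|∇v|²/h) v + (h²/4)(H·d) (DΨ(v))ᵀH, where ∇v·∇(log h) ∈ ℝ² has j-th entry ∑ₖ ∂ₖv_j ∂ₖ(log h) and (DΨ(v))ᵀH ∈ ℝ² has j-th entry ∑ᵢ (∂Ψᵢ/∂v_j)(v) Hᵢ. -/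

import Mathlib

noncomputable section

/-- Space-time `ℝ³ × ℝ`. -/
abbrev SpaceTime := (Fin 3 → ℝ) × ℝ

/-- Euclidean dot product on `ℝ³`. -/
def dot3 (a b : Fin 3 → ℝ) : ℝ := ∑ i, a i * b i

/-- Time partial derivative `∂ₜu`. -/
def pt (u : SpaceTime → ℝ) (p : SpaceTime) : ℝ :=
  lineDeriv ℝ u p ((0 : Fin 3 → ℝ), (1 : ℝ))

/-- Spatial partial derivative `∂ₖu`. -/
def px (k : Fin 3) (u : SpaceTime → ℝ) (p : SpaceTime) : ℝ :=
  lineDeriv ℝ u p (Pi.single k 1, (0 : ℝ))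

/-- Spatial Laplacian `Δu = ∑ₖ ∂ₖ∂ₖu`. -/
def lap (u : SpaceTime → ℝ) (p : SpaceTime) : ℝ := ∑ k, px k (px k u) p

/-- `|∇d|²`, the sum of the squares of all spatial partial derivatives of all components. -/
def gradSq (d : SpaceTime → Fin 3 → ℝ) (p : SpaceTime) : ℝ :=
  ∑ i, ∑ k, (px k (fun q => d q i) p) ^ 2

/-- `u` is C² on `U`: `u`, `∂ₜu` and all first and second spatial partial derivatives
exist and are continuous on `U`. -/
def IsC2On (u : SpaceTime → ℝ) (U : Set SpaceTime) : Prop :=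
  ContinuousOn u U ∧
  (∀ p ∈ U, LineDifferentiableAt ℝ u p ((0 : Fin 3 → ℝ), (1 : ℝ))) ∧
  ContinuousOn (pt u) U ∧
  (∀ k : Fin 3,
    (∀ p ∈ U, LineDifferentiableAt ℝ u p (Pi.single k 1, (0 : ℝ))) ∧
    ContinuousOn (px k u) U) ∧
  (∀ k l : Fin 3,
    (∀ p ∈ U, LineDifferentiableAt ℝ (px l u) p (Pi.single k 1, (0 : ℝ))) ∧
    ContinuousOn (px k (px l u)) U)

/-- Inverse stereographic projection `Ψ : ℝ² → S² ⊆ ℝ³`. -/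
def Psi (v : Fin 2 → ℝ) : Fin 3 → ℝ :=
  ![2 * v 0 / (1 + v 0 ^ 2 + v 1 ^ 2),
    2 * v 1 / (1 + v 0 ^ 2 + v 1 ^ 2),
    (1 - v 0 ^ 2 - v 1 ^ 2) / (1 + v 0 ^ 2 + v 1 ^ 2)]

/-- `(∂Ψᵢ/∂v_j)(w)`. -/
def psiD (j : Fin 2) (i : Fin 3) (w : Fin 2 → ℝ) : ℝ :=
  lineDeriv ℝ (fun u => Psi u i) w (Pi.single j 1)

/-- `|∇v|²` for an `ℝ²`-valued map on space-time. -/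
def gradSq2 (v : SpaceTime → Fin 2 → ℝ) (p : SpaceTime) : ℝ :=
  ∑ j : Fin 2, ∑ k : Fin 3, (px k (fun q => v q j) p) ^ 2

/-- Stereographic coordinates of a sphere-valued map `d` with `d₃ > −1`:
`vⱼ = dⱼ/(1 + d₃)` for `j = 1, 2`. -/
def stereo (d : SpaceTime → Fin 3 → ℝ) (q : SpaceTime) : Fin 2 → ℝ :=
  fun j => d q j.castSucc / (1 + d q 2)

section LineDerivRules

variable {E : Type*} [AddCommGroup E] [Module ℝ E] {f g : E → ℝ} {f' g' : ℝ} {x v : E}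

lemma HasLineDerivAt.real_add (hf : HasLineDerivAt ℝ f f' x v) (hg : HasLineDerivAt ℝ g g' x v) :
    HasLineDerivAt ℝ (fun q => f q + g q) (f' + g') x v :=
  HasDerivAt.add hf hg

lemma HasLineDerivAt.real_sub (hf : HasLineDerivAt ℝ f f' x v) (hg : HasLineDerivAt ℝ g g' x v) :
    HasLineDerivAt ℝ (fun q => f q - g q) (f' - g') x v :=
  HasDerivAt.sub hf hg

lemma HasLineDerivAt.real_mul (hf : HasLineDerivAt ℝ f f' x v) (hg : HasLineDerivAt ℝ g g' x v) :
    HasLineDerivAt ℝ (fun q => f q * g q) (f' * g x + f x * g') x v := by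
  simpa [HasLineDerivAt, Pi.mul_def, Pi.div_def, Pi.pow_def] using HasDerivAt.mul hf hg

lemma HasLineDerivAt.real_div (hf : HasLineDerivAt ℝ f f' x v) (hg : HasLineDerivAt ℝ g g' x v)
    (h : g x ≠ 0) :
    HasLineDerivAt ℝ (fun q => f q / g q) ((f' * g x - f x * g') / g x ^ 2) x v := by
  simpa [HasLineDerivAt, Pi.mul_def, Pi.div_def, Pi.pow_def] using HasDerivAt.div hf hg (by simpa using h)

lemma HasLineDerivAt.real_sq (hf : HasLineDerivAt ℝ f f' x v) :
    HasLineDerivAt ℝ (fun q => f q ^ 2) (2 * f x * f') x v := by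
  simpa [HasLineDerivAt, Pi.mul_def, Pi.div_def, Pi.pow_def] using HasDerivAt.pow hf 2

lemma HasLineDerivAt.real_log (hf : HasLineDerivAt ℝ f f' x v) (h : f x ≠ 0) :
    HasLineDerivAt ℝ (fun q => Real.log (f q)) (f' / f x) x v := by
  simpa [HasLineDerivAt, Pi.mul_def, Pi.div_def, Pi.pow_def] using HasDerivAt.log hf (by simpa using h)

lemma hasLineDerivAt_real_const (c : ℝ) (x v : E) : HasLineDerivAt ℝ (fun _ : E => c) 0 x v :=
  hasDerivAt_const _ _

end LineDerivRules

/-- Second derivative of `f / g` along a line, in terms of the derivatives `a, b` of `f, g` in the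
inner direction, `a', b'` in the outer direction, and the mixed ones `a₂, b₂`. -/
def quotSecond (f g a b a' b' a₂ b₂ : ℝ) : ℝ :=
  ((a₂ * g + a * b' - (a' * b + f * b₂)) * g ^ 2 - (a * g - f * b) * (2 * g * b')) / (g ^ 2) ^ 2

section Quotient

variable {U : Set SpaceTime} {f g : SpaceTime → ℝ}

lemma IsC2On.hasLineDerivAt_pt (hf : IsC2On f U) {p : SpaceTime} (hp : p ∈ U) :
    HasLineDerivAt ℝ f (pt f p) p (0, 1) :=
  (hf.2.1 p hp).hasLineDerivAt

lemma IsC2On.hasLineDerivAt_px (hf : IsC2On f U) (k : Fin 3) {p : SpaceTime} (hp : p ∈ U) :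
    HasLineDerivAt ℝ f (px k f p) p (Pi.single k 1, 0) :=
  ((hf.2.2.2.1 k).1 p hp).hasLineDerivAt

lemma IsC2On.hasLineDerivAt_px_px (hf : IsC2On f U) (k l : Fin 3) {p : SpaceTime} (hp : p ∈ U) :
    HasLineDerivAt ℝ (px l f) (px k (px l f) p) p (Pi.single k 1, 0) :=
  ((hf.2.2.2.2 k l).1 p hp).hasLineDerivAt

lemma HasLineDerivAt.congr_of_isOpen {f f₁ : SpaceTime → ℝ} {f' : ℝ} {p v : SpaceTime}
    (h : HasLineDerivAt ℝ f f' p v) (hU : IsOpen U) (hp : p ∈ U)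
    (heq : ∀ q ∈ U, f₁ q = f q) : HasLineDerivAt ℝ f₁ f' p v :=
  h.congr_of_eventuallyEq (Filter.eventually_of_mem (hU.mem_nhds hp) heq)

lemma IsC2On.pt_div (hf : IsC2On f U) (hg : IsC2On g U) (h0 : ∀ p ∈ U, g p ≠ 0)
    {p : SpaceTime} (hp : p ∈ U) :
    pt (fun q => f q / g q) p = (pt f p * g p - f p * pt g p) / g p ^ 2 :=
  ((hf.hasLineDerivAt_pt hp).real_div (hg.hasLineDerivAt_pt hp) (h0 p hp)).lineDeriv

lemma IsC2On.px_div (hf : IsC2On f U) (hg : IsC2On g U) (h0 : ∀ p ∈ U, g p ≠ 0) (k : Fin 3)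
    {p : SpaceTime} (hp : p ∈ U) :
    px k (fun q => f q / g q) p = (px k f p * g p - f p * px k g p) / g p ^ 2 :=
  ((hf.hasLineDerivAt_px k hp).real_div (hg.hasLineDerivAt_px k hp) (h0 p hp)).lineDeriv

lemma IsC2On.hasLineDerivAt_px_div (hU : IsOpen U) (hf : IsC2On f U) (hg : IsC2On g U)
    (h0 : ∀ p ∈ U, g p ≠ 0) (k l : Fin 3) {p : SpaceTime} (hp : p ∈ U) :
    HasLineDerivAt ℝ (px l (fun q => f q / g q))
      (quotSecond (f p) (g p) (px l f p) (px l g p) (px k f p) (px k g p)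
        (px k (px l f) p) (px k (px l g) p)) p (Pi.single k 1, 0) := by
  have hf1 := hf.hasLineDerivAt_px k hp
  have hg1 := hg.hasLineDerivAt_px k hp
  have h := ((((hf.hasLineDerivAt_px_px k l hp).real_mul hg1).real_sub
    (hf1.real_mul (hg.hasLineDerivAt_px_px k l hp))).real_div hg1.real_sq
      (pow_ne_zero 2 (h0 p hp)))
  exact h.congr_of_isOpen hU hp fun q hq => hf.px_div hg h0 l hq

lemma IsC2On.div (hU : IsOpen U) (hf : IsC2On f U) (hg : IsC2On g U)
    (h0 : ∀ p ∈ U, g p ≠ 0) : IsC2On (fun q => f q / g q) U := by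
  have hfc := hf.1
  have hgc := hg.1
  refine ⟨hfc.div hgc h0, fun p hp => ((hf.hasLineDerivAt_pt hp).real_div
    (hg.hasLineDerivAt_pt hp) (h0 p hp)).lineDifferentiableAt, ?_, fun k => ⟨fun p hp =>
    ((hf.hasLineDerivAt_px k hp).real_div (hg.hasLineDerivAt_px k hp)
      (h0 p hp)).lineDifferentiableAt, ?_⟩, fun k l => ⟨fun p hp =>
    (hf.hasLineDerivAt_px_div hU hg h0 k l hp).lineDifferentiableAt, ?_⟩⟩
  · exact (((hf.2.2.1.mul hgc).sub (hfc.mul hg.2.2.1)).div (hgc.pow 2)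
      fun p hp => pow_ne_zero 2 (h0 p hp)).congr fun p hp => hf.pt_div hg h0 hp
  · exact ((((hf.2.2.2.1 k).2.mul hgc).sub (hfc.mul (hg.2.2.2.1 k).2)).div (hgc.pow 2)
      fun p hp => pow_ne_zero 2 (h0 p hp)).congr fun p hp => hf.px_div hg h0 k hp
  · have hfk := (hf.2.2.2.1 k).2
    have hfl := (hf.2.2.2.1 l).2
    have hgk := (hg.2.2.2.1 k).2
    have hgl := (hg.2.2.2.1 l).2
    have hfkl := (hf.2.2.2.2 k l).2
    have hgkl := (hg.2.2.2.2 k l).2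
    refine ContinuousOn.congr (f := fun p => quotSecond (f p) (g p) (px l f p) (px l g p)
      (px k f p) (px k g p) (px k (px l f) p) (px k (px l g) p)) ?_
      fun p hp => (hf.hasLineDerivAt_px_div hU hg h0 k l hp).lineDeriv
    unfold quotSecond
    exact ContinuousOn.div (by fun_prop) (by fun_prop)
      fun p hp => pow_ne_zero 2 (pow_ne_zero 2 (h0 p hp))

end Quotient

lemma pt_const_add (c : ℝ) (f : SpaceTime → ℝ) : pt (fun q => c + f q) = pt f := by
  funext p
  simp [pt, lineDeriv]

lemma px_const_add (c : ℝ) (f : SpaceTime → ℝ) (k : Fin 3) :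
    px k (fun q => c + f q) = px k f := by
  funext p
  simp [px, lineDeriv]

lemma IsC2On.const_add {f : SpaceTime → ℝ} {U : Set SpaceTime} (hf : IsC2On f U) (c : ℝ) :
    IsC2On (fun q => c + f q) U := by
  refine ⟨continuousOn_const.add hf.1, fun p hp => ((hasLineDerivAt_real_const c p _).real_add
    (hf.hasLineDerivAt_pt hp)).lineDifferentiableAt, ?_, fun k => ⟨fun p hp =>
    ((hasLineDerivAt_real_const c p _).real_add
      (hf.hasLineDerivAt_px k hp)).lineDifferentiableAt, ?_⟩, ?_⟩
  · rw [pt_const_add]; exact hf.2.2.1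
  · rw [px_const_add]; exact (hf.2.2.2.1 k).2
  · simp only [px_const_add]; exact hf.2.2.2.2

lemma hasLineDerivAt_apply {n : ℕ} (j m : Fin n) (w : Fin n → ℝ) :
    HasLineDerivAt ℝ (fun u : Fin n → ℝ => u m) ((Pi.single j 1 : Fin n → ℝ) m) w (Pi.single j 1) := by
  have h := ((hasDerivAt_id (0 : ℝ)).mul_const ((Pi.single j 1 : Fin n → ℝ) m)).const_add (w m)
  simpa [HasLineDerivAt] using h

lemma hasLineDerivAt_stereoDenom (j : Fin 2) (w : Fin 2 → ℝ) :
    HasLineDerivAt ℝ (fun u : Fin 2 → ℝ => 1 + u 0 ^ 2 + u 1 ^ 2) (2 * w j) w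
      (Pi.single j 1) := by
  have h := ((hasLineDerivAt_real_const 1 w (Pi.single j 1)).real_add
    (hasLineDerivAt_apply j 0 w).real_sq).real_add (hasLineDerivAt_apply j 1 w).real_sq
  convert h using 1
  fin_cases j <;> simp

lemma psiD_castSucc (j m : Fin 2) (w : Fin 2 → ℝ) :
    psiD j m.castSucc w = (2 * ((Pi.single j 1 : Fin 2 → ℝ) m) * (1 + w 0 ^ 2 + w 1 ^ 2)
      - 2 * w m * (2 * w j)) / (1 + w 0 ^ 2 + w 1 ^ 2) ^ 2 := by
  have h := ((hasLineDerivAt_real_const 2 w (Pi.single j 1)).real_mul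
    (hasLineDerivAt_apply j m w)).real_div (hasLineDerivAt_stereoDenom j w)
      (by positivity)
  rw [zero_mul, zero_add] at h
  rw [← h.lineDeriv, psiD]
  fin_cases m <;> rfl

lemma psiD_two (j : Fin 2) (w : Fin 2 → ℝ) :
    psiD j 2 w = -(4 * w j) / (1 + w 0 ^ 2 + w 1 ^ 2) ^ 2 := by
  have h := (((hasLineDerivAt_real_const 2 w (Pi.single j 1)).real_sub
    (hasLineDerivAt_stereoDenom j w))).real_div (hasLineDerivAt_stereoDenom j w)
      (by positivity)
  have h2 : (fun u : Fin 2 → ℝ => Psi u 2) =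
      fun u => (2 - (1 + u 0 ^ 2 + u 1 ^ 2)) / (1 + u 0 ^ 2 + u 1 ^ 2) := by
    funext u
    simp only [Psi, Matrix.cons_val]
    ring
  rw [psiD, h2, h.lineDeriv]
  ring

lemma one_add_stereo_sq {d : SpaceTime → Fin 3 → ℝ} {p : SpaceTime}
    (hunit : dot3 (d p) (d p) = 1) (hd3 : -1 < d p 2) :
    1 + stereo d p 0 ^ 2 + stereo d p 1 ^ 2 = 2 / (1 + d p 2) := by
  have hs : 1 + d p 2 ≠ 0 := by linarith
  simp only [dot3, Fin.sum_univ_three] at hunit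
  simp only [stereo, Fin.castSucc_zero, show (1 : Fin 2).castSucc = (1 : Fin 3) from rfl]
  field_simp
  linear_combination hunit

lemma sum_mul_px_eq_zero {U : Set SpaceTime} (hU : IsOpen U) {d : SpaceTime → Fin 3 → ℝ}
    (hd : ∀ i : Fin 3, IsC2On (fun p => d p i) U)
    (hunit : ∀ p ∈ U, dot3 (d p) (d p) = 1) (k : Fin 3) {p : SpaceTime} (hp : p ∈ U) :
    ∑ i, d p i * px k (fun q => d q i) p = 0 := by
  have h := (((hd 0).hasLineDerivAt_px k hp).real_sq.real_add
    ((hd 1).hasLineDerivAt_px k hp).real_sq).real_add ((hd 2).hasLineDerivAt_px k hp).real_sq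
  have hc := (hasLineDerivAt_real_const 1 p (Pi.single k 1, 0)).congr_of_isOpen hU hp
    (f₁ := fun q => d q 0 ^ 2 + d q 1 ^ 2 + d q 2 ^ 2) fun q hq => by
      rw [← hunit q hq, dot3, Fin.sum_univ_three]; ring
  have := h.unique hc
  rw [Fin.sum_univ_three]
  linarith

lemma px_log_stereo {U : Set SpaceTime} (hU : IsOpen U) {d : SpaceTime → Fin 3 → ℝ}
    (hd : IsC2On (fun p => d p 2) U) (hunit : ∀ p ∈ U, dot3 (d p) (d p) = 1)
    (hd3 : ∀ p ∈ U, -1 < d p 2) (k : Fin 3) {p : SpaceTime} (hp : p ∈ U) :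
    px k (fun q => Real.log (1 + (stereo d q 0) ^ 2 + (stereo d q 1) ^ 2)) p =
      -(px k (fun q => d q 2) p / (1 + d p 2)) := by
  have hs : ∀ q ∈ U, 1 + d q 2 ≠ 0 := fun q hq => by linarith [hd3 q hq]
  have h := (hasLineDerivAt_real_const (Real.log 2) p (Pi.single k 1, 0)).real_sub
    (((hd.const_add 1).hasLineDerivAt_px k hp).real_log (hs p hp))
  rw [px_const_add, zero_sub] at h
  refine (h.congr_of_isOpen hU hp fun q hq => ?_).lineDeriv
  rw [one_add_stereo_sq (hunit q hq) (hd3 q hq), Real.log_div two_ne_zero (hs q hq)]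

/-- Stereographic projection is conformal: `|∇v|² = |∇d|² / (1 + d₃)²`. -/
lemma gradSq2_stereo {U : Set SpaceTime} (hU : IsOpen U) {d : SpaceTime → Fin 3 → ℝ}
    (hd : ∀ i : Fin 3, IsC2On (fun p => d p i) U)
    (hunit : ∀ p ∈ U, dot3 (d p) (d p) = 1) (hd3 : ∀ p ∈ U, -1 < d p 2)
    {p : SpaceTime} (hp : p ∈ U) :
    gradSq2 (stereo d) p = gradSq d p / (1 + d p 2) ^ 2 := by
  have hs : ∀ q ∈ U, 1 + d q 2 ≠ 0 := fun q hq => by linarith [hd3 q hq]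
  have hsp := hs p hp
  have hu := hunit p hp
  simp only [dot3, Fin.sum_univ_three] at hu
  simp only [gradSq2, gradSq]
  rw [Finset.sum_comm, Finset.sum_comm (s := (Finset.univ : Finset (Fin 3)))
    (t := (Finset.univ : Finset (Fin 3))), Finset.sum_div]
  refine Finset.sum_congr rfl fun k _ => ?_
  have hk := sum_mul_px_eq_zero hU hd hunit k hp
  simp only [stereo]
  simp only [(hd _).px_div ((hd 2).const_add 1) hs k hp, px_const_add]
  simp only [Fin.sum_univ_three, Fin.sum_univ_two, Fin.castSucc_zero,
    show (1 : Fin 2).castSucc = (1 : Fin 3) from rfl] at hk ⊢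
  field_simp
  linear_combination (px k (fun q => d q 2) p) ^ 2 * hu
    - 2 * (1 + d p 2) * px k (fun q => d q 2) p * hk

/-- The second-order part of the equation for `v = Ψ⁻¹ ∘ d`. -/
lemma lap_stereo {U : Set SpaceTime} (hU : IsOpen U) {d : SpaceTime → Fin 3 → ℝ}
    (hd : ∀ i : Fin 3, IsC2On (fun p => d p i) U)
    (hunit : ∀ p ∈ U, dot3 (d p) (d p) = 1) (hd3 : ∀ p ∈ U, -1 < d p 2) (j : Fin 2)
    {p : SpaceTime} (hp : p ∈ U) :
    lap (fun q => stereo d q j) p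
      - 2 * ∑ k, px k (fun q => stereo d q j) p
          * px k (fun q => Real.log (1 + (stereo d q 0) ^ 2 + (stereo d q 1) ^ 2)) p =
      (lap (fun q => d q j.castSucc) p * (1 + d p 2) - d p j.castSucc * lap (fun q => d q 2) p)
        / (1 + d p 2) ^ 2 := by
  have hs : ∀ q ∈ U, 1 + d q 2 ≠ 0 := fun q hq => by linarith [hd3 q hq]
  have hsp := hs p hp
  simp only [lap, Finset.mul_sum, Finset.sum_mul, ← Finset.sum_sub_distrib, Finset.sum_div]
  refine Finset.sum_congr rfl fun k _ => ?_
  rw [px_log_stereo hU (hd 2) hunit hd3 k hp]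
  have h2 : px k (px k (fun q => stereo d q j)) p = _ :=
    ((hd j.castSucc).hasLineDerivAt_px_div hU ((hd 2).const_add 1) hs k k hp).lineDeriv
  rw [h2]
  simp only [stereo]
  simp only [(hd _).px_div ((hd 2).const_add 1) hs k hp, px_const_add, quotSecond]
  field_simp
  ring

/-- The projected external field term, `(h²/4) (DΨ(v))ᵀ H`. -/
lemma sum_psiD_stereo {d : SpaceTime → Fin 3 → ℝ} {p : SpaceTime}
    (hunit : dot3 (d p) (d p) = 1) (hd3 : -1 < d p 2) (η : Fin 3 → ℝ) (j : Fin 2) :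
    ∑ i, psiD j i (stereo d p) * η i =
      (1 + d p 2) * η j.castSucc - d p j.castSucc * (dot3 η (d p) + η 2) := by
  have hs : 1 + d p 2 ≠ 0 := by linarith
  rw [Fin.sum_univ_three, psiD_two, show (0 : Fin 3) = (0 : Fin 2).castSucc from rfl,
    show (1 : Fin 3) = (1 : Fin 2).castSucc from rfl, psiD_castSucc, psiD_castSucc,
    one_add_stereo_sq hunit hd3]
  simp only [dot3, Fin.sum_univ_three, stereo]
  fin_cases j <;> simp <;> field_simp <;> ring

/-- If the sphere-valued map `d` with `d₃ > −1` solves the harmonic map heat flow with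
external field `H`, then `v = Ψ⁻¹ ∘ d` is C² and solves the projected system. -/
theorem statement1 (U : Set SpaceTime) (hU : IsOpen U)
    (H : SpaceTime → Fin 3 → ℝ) (hH : ContinuousOn H U)
    (d : SpaceTime → Fin 3 → ℝ)
    (hd : ∀ i : Fin 3, IsC2On (fun p => d p i) U)
    (hunit : ∀ p ∈ U, dot3 (d p) (d p) = 1)
    (hd3 : ∀ p ∈ U, -1 < d p 2)
    (heq : ∀ p ∈ U, ∀ i : Fin 3,
      pt (fun q => d q i) p - lap (fun q => d q i) p =
        gradSq d p * d p i + dot3 (H p) (d p) * H p i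
          - (dot3 (H p) (d p)) ^ 2 * d p i) :
    (∀ j : Fin 2, IsC2On (fun p => stereo d p j) U) ∧
    ∀ p ∈ U, ∀ j : Fin 2,
      pt (fun q => stereo d q j) p =
        lap (fun q => stereo d q j) p
          - 2 * ∑ k, px k (fun q => stereo d q j) p
              * px k (fun q => Real.log (1 + (stereo d q 0) ^ 2 + (stereo d q 1) ^ 2)) p
          + 2 * gradSq2 (stereo d) p / (1 + (stereo d p 0) ^ 2 + (stereo d p 1) ^ 2)
              * stereo d p j
          + (1 + (stereo d p 0) ^ 2 + (stereo d p 1) ^ 2) ^ 2 / 4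
              * dot3 (H p) (d p) * ∑ i, psiD j i (stereo d p) * H p i := by
  have hs : ∀ q ∈ U, 1 + d q 2 ≠ 0 := fun q hq => by linarith [hd3 q hq]
  refine ⟨fun j => (hd j.castSucc).div hU ((hd 2).const_add 1) hs, fun p hp j => ?_⟩
  have hsp := hs p hp
  have ht : pt (fun q => stereo d q j) p = _ :=
    (hd j.castSucc).pt_div ((hd 2).const_add 1) hs hp
  rw [lap_stereo hU hd hunit hd3 j hp, gradSq2_stereo hU hd hunit hd3 hp,
    sum_psiD_stereo (hunit p hp) (hd3 p hp), one_add_stereo_sq (hunit p hp) (hd3 p hp), ht,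
    pt_const_add]
  have hj := heq p hp j.castSucc
  have h2 := heq p hp 2
  simp only [stereo]
  field_simp
  linear_combination 4 * (1 + d p 2) * hj - 4 * d p j.castSucc * h2
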